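/- arXiv:2409.16989 — 2 statements merged into one kernel-verified Lean document; each statement's English description precedes it below -/
import Mathlib

section
/- Fix ρ ∈ (0,1), t > 0, an integer n ≥ 1 and a strictly decreasing map X₀ : {1,…,n} → ℤ. For each 0 ≤ k ≤ n−1 let h_k solve the backwards-heat IBVP for (ρ,n,k,X₀), and define Ψ^n_{ρ,k} and Φ^n_{ρ,k} as below. Then the sums defining Φ^n_{ρ,k} converge absolutely, and for all 0 ≤ k, l ≤ n−1 the sum Σ_{x∈ℤ} Ψ^n_{ρ,l}(x)·Φ^n_{ρ,k}(x) converges absolutely and equals 1 if k = l and 0 otherwise (the biorthogonalization relation). -/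
/-- `R_{ρ,t}(x,y) = e^{−t}(1−ρ)^{x−y} t^{x−y}/(x−y)!` for `x ≥ y`, `0` otherwise. -/
noncomputable def Rker (ρ t : ℝ) (x y : ℤ) : ℝ :=
  if y ≤ x then
    Real.exp (-t) * (1 - ρ) ^ (x - y) * t ^ (x - y).toNat / (Nat.factorial (x - y).toNat)
  else 0

/-- `R_{ρ,t}^{-1}(x,y) = e^{t}(1−ρ)^{x−y}(−t)^{x−y}/(x−y)!` for `x ≥ y`, `0` otherwise. -/
noncomputable def Rinv (ρ t : ℝ) (x y : ℤ) : ℝ :=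
  if y ≤ x then
    Real.exp t * (1 - ρ) ^ (x - y) * (-t) ^ (x - y).toNat / (Nat.factorial (x - y).toNat)
  else 0

/-- `Q_ρ^{-1}(x,y) = (1/ρ)·1_{x=y−1} − ((1−ρ)/ρ)·1_{x=y}`. -/
noncomputable def Qinv (ρ : ℝ) (x y : ℤ) : ℝ :=
  (1 / ρ) * (if x = y - 1 then 1 else 0) - ((1 - ρ) / ρ) * (if x = y then 1 else 0)

/-- `Q_ρ^{-k}`, the `k`-fold convolution power of `Q_ρ^{-1}`, with `Q_ρ^{-0}` the identity. -/
noncomputable def Qinvpow (ρ : ℝ) : ℕ → ℤ → ℤ → ℝ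
  | 0 => fun x y => if x = y then 1 else 0
  | k + 1 => fun x y => ∑' z : ℤ, Qinv ρ x z * Qinvpow ρ k z y

/-- `h` solves the backwards-heat initial–boundary value problem for `(ρ, n, k, X₀)`. -/
def SolvesIBVP (ρ : ℝ) (n k : ℕ) (X₀ : ℕ → ℤ) (h : ℕ → ℤ → ℝ) : Prop :=
  (∀ l, l < k → ∀ z : ℤ, (1 / ρ) * h l (z - 1) - ((1 - ρ) / ρ) * h l z = h (l + 1) z) ∧
  (∀ z : ℤ, h k z = ρ * (1 - ρ) ^ (X₀ (n - k) - z - 1)) ∧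
  (∀ l, l < k → h l (X₀ (n - l)) = 0)

/-- `Ψ^n_{ρ,k}(x) := Σ_y R_{ρ,t}(x,y) Q_ρ^{-k}(y, X₀(n−k))`. -/
noncomputable def Psi (ρ t : ℝ) (n k : ℕ) (X₀ : ℕ → ℤ) (x : ℤ) : ℝ :=
  ∑' y : ℤ, Rker ρ t x y * Qinvpow ρ k y (X₀ (n - k))

/-- `Φ^n_{ρ,k}(z) := Σ_y ((1−ρ)/ρ) h_k(0,y) R_{ρ,t}^{-1}(y,z)`, where `hk0 = h_k(0,·)`. -/
noncomputable def Phi (ρ t : ℝ) (hk0 : ℤ → ℝ) (z : ℤ) : ℝ :=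
  ∑' y : ℤ, ((1 - ρ) / ρ) * hk0 y * Rinv ρ t y z

/-- Exponential growth of `f` to the right of every point, at rate `B`. -/
def RightExpBounded (B : ℝ) (f : ℤ → ℝ) : Prop :=
  ∀ y : ℤ, ∃ C : ℝ, ∀ m : ℕ, |f (y + m)| ≤ C * B ^ m

theorem Rinv_eq_Rker (ρ t : ℝ) (x y : ℤ) : Rinv ρ t x y = Rker ρ (-t) x y := by
  simp [Rinv, Rker]

theorem Rker_add_natCast (ρ t : ℝ) (y : ℤ) (m : ℕ) :
    Rker ρ t (y + m) y = Real.exp (-t) * (((1 - ρ) * t) ^ m / (Nat.factorial m)) := by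
  simp [Rker, mul_pow]
  ring

theorem Rker_of_lt (ρ t : ℝ) {x y : ℤ} (hxy : x < y) : Rker ρ t x y = 0 := by
  simp [Rker, hxy.not_ge]

theorem summable_Rker_mul_Rinv (ρ t : ℝ) {B : ℝ} {f : ℤ → ℝ}
    (hf : RightExpBounded B f) (y : ℤ) :
    Summable fun p : ℤ × ℤ => Rker ρ t p.1 y * (f p.2 * Rinv ρ t p.2 p.1) := by
  let i : ℕ × ℕ → ℤ × ℤ := fun q => (y + q.1, y + q.1 + q.2)
  have hi : Function.Injective i := by
    rintro ⟨a, b⟩ ⟨c, d⟩ hq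
    simp only [i, Prod.mk.injEq] at hq ⊢
    omega
  rw [← hi.summable_iff]
  · obtain ⟨C, hC⟩ := hf y
    have hs := Real.summable_pow_div_factorial (|(1 - ρ) * t| * |B|)
    have hs2 := (hs.mul_of_nonneg hs (fun _ => by positivity)
      (fun _ => by positivity)).mul_left C
    refine Summable.of_norm_bounded hs2 ?_
    rintro ⟨m, j⟩
    have hb : |f (y + m + j)| ≤ C * |B| ^ (m + j) := by
      have hC0 : 0 ≤ C := by simpa using (abs_nonneg _).trans (hC 0)
      have := hC (m + j)
      rw [Nat.cast_add, ← add_assoc] at this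
      refine this.trans (mul_le_mul_of_nonneg_left ?_ hC0)
      rw [← abs_pow]
      exact le_abs_self _
    have he : Real.exp (-t) * Real.exp t = 1 := by rw [← Real.exp_add]; simp
    simp only [i, Function.comp, Rinv_eq_Rker, Rker_add_natCast, Real.norm_eq_abs, neg_neg]
    simp only [abs_mul, abs_div, abs_pow, Real.abs_exp, Nat.abs_cast, abs_neg]
    calc _ = (Real.exp (-t) * Real.exp t) * |f (y + m + j)| *
          (((|1 - ρ| * |t|) ^ m / m.factorial) * ((|1 - ρ| * |t|) ^ j / j.factorial)) := by ring
      _ ≤ (C * |B| ^ (m + j)) *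
          (((|1 - ρ| * |t|) ^ m / m.factorial) * ((|1 - ρ| * |t|) ^ j / j.factorial)) := by
          rw [he, one_mul]
          exact mul_le_mul_of_nonneg_right hb (by positivity)
      _ = _ := by
          rw [pow_add, mul_pow _ (|B|), mul_pow _ (|B|)]
          ring
  · rintro ⟨x, z⟩ hxz
    by_cases h1 : x < y
    · simp [Rker_of_lt ρ t h1]
    · by_cases h2 : z < x
      · simp [Rinv_eq_Rker, Rker_of_lt ρ (-t) h2]
      · exact absurd ⟨((x - y).toNat, (z - x).toNat), by simp [i]; omega⟩ hxz

theorem summable_mul_Rinv (ρ t : ℝ) {B : ℝ} {f : ℤ → ℝ}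
    (hf : RightExpBounded B f) (z : ℤ) : Summable fun y : ℤ => f y * Rinv ρ t y z := by
  have h1 := (summable_Rker_mul_Rinv ρ t hf z).prod_factor z
  have h2 : Rker ρ t z z = Real.exp (-t) := by simpa using Rker_add_natCast ρ t z 0
  simp only [h2] at h1
  exact (summable_mul_left_iff (Real.exp_ne_zero _)).1 h1

theorem tsum_Rker_mul_Rinv (ρ t : ℝ) (y z : ℤ) :
    ∑' x : ℤ, Rker ρ t x y * Rinv ρ t z x = if z = y then 1 else 0 := by
  by_cases hzy : z < y
  · rw [if_neg hzy.ne]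
    refine (tsum_congr fun x => ?_).trans tsum_zero
    by_cases h1 : x < y
    · simp [Rker_of_lt ρ t h1]
    · simp [Rinv_eq_Rker, Rker_of_lt ρ (-t) (show z < x by omega)]
  obtain ⟨s, rfl⟩ : ∃ s : ℕ, z = y + s := ⟨(z - y).toNat, by omega⟩
  have hi : Function.Injective fun m : ℕ => y + (m : ℤ) := fun a b hab => by simpa using hab
  rw [← hi.tsum_eq, tsum_eq_sum (s := Finset.range (s + 1))]
  · have he : Real.exp (-t) * Real.exp t = 1 := by rw [← Real.exp_add]; simp
    have key : ∀ m ∈ Finset.range (s + 1),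
        Rker ρ t (y + m) y * Rinv ρ t (y + s) (y + m) =
          ((1 - ρ) * t) ^ m * (-((1 - ρ) * t)) ^ (s - m) * (s.choose m) / s.factorial := by
      intro m hm
      have hms : m ≤ s := by simpa [Nat.lt_succ_iff] using hm
      have : y + (s : ℤ) = y + m + ((s - m : ℕ) : ℤ) := by omega
      rw [this, Rinv_eq_Rker, Rker_add_natCast, Rker_add_natCast, neg_neg,
        Nat.cast_choose ℝ hms]
      have := Nat.factorial_ne_zero m
      have := Nat.factorial_ne_zero s
      have := Nat.factorial_ne_zero (s - m)
      field_simp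
      linear_combination ((1 - ρ) * t) ^ m * (-((1 - ρ) * t)) ^ (s - m) * he
    rw [Finset.sum_congr rfl key, ← Finset.sum_div, ← add_pow]
    rcases Nat.eq_zero_or_pos s with rfl | hs
    · simp
    · simp [hs.ne']
  · intro m hm
    have : s < m := by simpa using hm
    simp [Rinv_eq_Rker, Rker_of_lt ρ (-t) (show y + (s : ℤ) < y + m by omega)]
  · intro x hx
    by_contra hn
    apply hx
    beta_reduce
    rw [Rker_of_lt ρ t, zero_mul]
    by_contra h1
    exact hn ⟨(x - y).toNat, by simp; omega⟩

theorem hasSum_Rker_mul_Phi (ρ t : ℝ) {B : ℝ} {f : ℤ → ℝ}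
    (hf : RightExpBounded B f) (y : ℤ) :
    HasSum (fun x => Rker ρ t x y * Phi ρ t f x) ((1 - ρ) / ρ * f y) := by
  have hs := (summable_Rker_mul_Rinv ρ t hf y).mul_left ((1 - ρ) / ρ)
  have hP : ∀ x, Rker ρ t x y * Phi ρ t f x =
      ∑' z, (1 - ρ) / ρ * (Rker ρ t x y * (f z * Rinv ρ t z x)) := by
    intro x
    rw [Phi, ← tsum_mul_left]
    exact tsum_congr fun z => by ring
  have hval : ∑' x, Rker ρ t x y * Phi ρ t f x = (1 - ρ) / ρ * f y := by
    rw [tsum_congr hP, ← Summable.tsum_comm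
      (f := fun x z => (1 - ρ) / ρ * (Rker ρ t x y * (f z * Rinv ρ t z x))) hs]
    have : ∀ z, ∑' x, (1 - ρ) / ρ * (Rker ρ t x y * (f z * Rinv ρ t z x)) =
        if z = y then (1 - ρ) / ρ * f y else 0 := by
      intro z
      have h1 : ∀ x, (1 - ρ) / ρ * (Rker ρ t x y * (f z * Rinv ρ t z x)) =
          ((1 - ρ) / ρ * f z) * (Rker ρ t x y * Rinv ρ t z x) := fun x => by ring
      rw [tsum_congr h1, tsum_mul_left, tsum_Rker_mul_Rinv]
      split_ifs with hz <;> simp [hz]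
    rw [tsum_congr this, tsum_ite_eq]
  rw [← hval]
  apply Summable.hasSum
  simp only [hP]
  exact hs.prod

theorem Qinvpow_succ (ρ : ℝ) (k : ℕ) (x y : ℤ) :
    Qinvpow ρ (k + 1) x y =
      (1 / ρ) * Qinvpow ρ k (x + 1) y - ((1 - ρ) / ρ) * Qinvpow ρ k x y := by
  change ∑' z : ℤ, Qinv ρ x z * Qinvpow ρ k z y = _
  rw [tsum_eq_sum (s := {x, x + 1})]
  · rw [Finset.sum_pair (by omega)]
    have h1 : x ≠ x - 1 := by omega
    simp [Qinv, h1]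
    ring
  · intro z hz
    simp only [Finset.mem_insert, Finset.mem_singleton, not_or] at hz
    have h1 : x ≠ z - 1 := by omega
    simp [Qinv, h1, Ne.symm hz.1]

theorem Qinvpow_eq_zero (ρ : ℝ) (k : ℕ) (x y : ℤ) (hx : x ∉ Finset.Icc (y - k) y) :
    Qinvpow ρ k x y = 0 := by
  induction k generalizing x with
  | zero =>
    have : x ≠ y := by rintro rfl; simp at hx
    simp [Qinvpow, this]
  | succ k ih =>
    simp only [Finset.mem_Icc] at hx ih
    rw [Qinvpow_succ, ih, ih] <;> first | (simp; done) | (push_cast at hx; omega)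

/-- The action of `Q_ρ^{-1}` on functions from the right: `f ↦ f Q_ρ^{-1}`. -/
noncomputable def backHeat (ρ : ℝ) : (ℤ → ℝ) →ₗ[ℝ] (ℤ → ℝ) where
  toFun f z := (1 / ρ) * f (z - 1) - ((1 - ρ) / ρ) * f z
  map_add' f g := by ext z; simp only [Pi.add_apply]; ring
  map_smul' c f := by ext z; simp only [Pi.smul_apply, smul_eq_mul, RingHom.id_apply]; ring

theorem hasSum_mul_Qinvpow (ρ : ℝ) (k : ℕ) (f : ℤ → ℝ) (X : ℤ) :
    HasSum (fun y => f y * Qinvpow ρ k y X) ((backHeat ρ ^ k) f X) := by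
  induction k generalizing f with
  | zero =>
    have : (fun y => f y * Qinvpow ρ 0 y X) = fun y => if y = X then f X else 0 := by
      ext y
      by_cases hy : y = X <;> simp [Qinvpow, hy]
    rw [this]
    simpa using hasSum_ite_eq X (f X)
  | succ k ih =>
    have h1 := (Equiv.addRight (1 : ℤ)).hasSum_iff.2 (ih fun z => f (z - 1))
    have h2 := (h1.mul_left (1 / ρ)).sub ((ih f).mul_left ((1 - ρ) / ρ))
    have hb : backHeat ρ f = (1 / ρ) • (fun z => f (z - 1)) - ((1 - ρ) / ρ) • f := rfl
    rw [pow_succ, Module.End.mul_apply, hb, map_sub, map_smul, map_smul]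
    simp only [Pi.sub_apply, Pi.smul_apply, smul_eq_mul]
    refine (congrArg (HasSum · _) (funext fun y => ?_)).mpr h2
    rw [Qinvpow_succ]
    simp only [Function.comp, Equiv.coe_addRight, add_sub_cancel_right]
    ring

theorem hasSum_Psi_mul_Phi (ρ t : ℝ) (n l : ℕ) (X₀ : ℕ → ℤ) {B : ℝ} {f : ℤ → ℝ}
    (hf : RightExpBounded B f) :
    HasSum (fun x => Psi ρ t n l X₀ x * Phi ρ t f x)
      ((1 - ρ) / ρ * (backHeat ρ ^ l) f (X₀ (n - l))) := by
  set X := X₀ (n - l) with hX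
  have hPsi : ∀ x, Psi ρ t n l X₀ x * Phi ρ t f x =
      ∑ y ∈ Finset.Icc (X - l) X, (Rker ρ t x y * Phi ρ t f x) * Qinvpow ρ l y X := by
    intro x
    rw [Psi, ← hX, tsum_eq_sum (s := Finset.Icc (X - l) X), Finset.sum_mul]
    · exact Finset.sum_congr rfl fun y _ => by ring
    · intro y hy
      rw [Qinvpow_eq_zero ρ l y X hy, mul_zero]
  have hsum : (1 - ρ) / ρ * (backHeat ρ ^ l) f X =
      ∑ y ∈ Finset.Icc (X - l) X, ((1 - ρ) / ρ * f y) * Qinvpow ρ l y X := by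
    rw [← (hasSum_mul_Qinvpow ρ l f X).tsum_eq, tsum_eq_sum (s := Finset.Icc (X - l) X),
      Finset.mul_sum]
    · exact Finset.sum_congr rfl fun y _ => by ring
    · intro y hy
      rw [Qinvpow_eq_zero ρ l y X hy, mul_zero]
  simp only [hPsi]
  rw [hsum]
  exact hasSum_sum fun y _ => (hasSum_Rker_mul_Phi ρ t hf y).mul_right _

theorem RightExpBounded.of_backHeat {ρ : ℝ} (hρ : ρ ∈ Set.Ioo (0 : ℝ) 1) {f : ℤ → ℝ}
    (hf : RightExpBounded (2 / (1 - ρ)) (backHeat ρ f)) :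
    RightExpBounded (2 / (1 - ρ)) f := by
  intro y
  obtain ⟨hρ0, hρ1⟩ := hρ
  have ha : 0 < 1 - ρ := by linarith
  obtain ⟨C', hC'⟩ := hf y
  refine ⟨max |f y| (2 * C' / (1 - ρ)), fun m => ?_⟩
  have hC'0 : 0 ≤ C' := by simpa using (abs_nonneg _).trans (hC' 0)
  set C := max |f y| (2 * C' / (1 - ρ)) with hC
  induction m with
  | zero => simp [hC]
  | succ m ih =>
    have h1 := hC' (m + 1)
    set g := backHeat ρ f (y + (m + 1 : ℕ)) with hg
    have hrec : f (y + (m + 1 : ℕ)) = (f (y + m) - ρ * g) / (1 - ρ) := by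
      have : y + ((m + 1 : ℕ) : ℤ) - 1 = y + m := by push_cast; ring
      simp only [hg, backHeat, LinearMap.coe_mk, AddHom.coe_mk, this]
      field_simp
      ring
    have hpos : 0 < (2 / (1 - ρ)) ^ (m + 1) := by positivity
    have h2 : |f (y + m) - ρ * g| ≤ |f (y + m)| + |g| := by
      refine (abs_sub _ _).trans ?_
      rw [abs_mul, abs_of_pos hρ0]
      nlinarith [abs_nonneg g]
    have h3 : C' / (1 - ρ) ≤ C / 2 := by
      have := le_max_right |f y| (2 * C' / (1 - ρ))
      rw [← hC] at this
      rw [mul_div_assoc] at this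
      linarith
    rw [hrec, abs_div, abs_of_pos ha]
    calc |f (y + m) - ρ * g| / (1 - ρ)
        ≤ (C * (2 / (1 - ρ)) ^ m + C' * (2 / (1 - ρ)) ^ (m + 1)) / (1 - ρ) := by
          gcongr
          linarith
      _ = (C / 2 + C' / (1 - ρ)) * (2 / (1 - ρ)) ^ (m + 1) := by
          rw [pow_succ]; field_simp
      _ ≤ C * (2 / (1 - ρ)) ^ (m + 1) := by
          gcongr
          linarith

theorem rightExpBounded_geometric {ρ : ℝ} (hρ : ρ ∈ Set.Ioo (0 : ℝ) 1) (c : ℝ) (X : ℤ) :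
    RightExpBounded (2 / (1 - ρ)) fun z => c * (1 - ρ) ^ (X - z - 1) := by
  intro y
  have ha : 0 < 1 - ρ := by linarith [hρ.2]
  refine ⟨|c| * (1 - ρ) ^ (X - y - 1), fun m => ?_⟩
  have : X - (y + m) - 1 = (X - y - 1) + -(m : ℤ) := by ring
  have h0 : 0 < (1 - ρ) ^ (X - y - 1) := by positivity
  beta_reduce
  rw [this, zpow_add₀ ha.ne', zpow_neg, zpow_natCast, abs_mul, abs_mul, abs_of_pos h0,
    abs_of_pos (show 0 < ((1 - ρ) ^ m)⁻¹ by positivity), ← mul_assoc, ← inv_pow, ← one_div]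
  gcongr
  norm_num

theorem backHeat_geometric {ρ : ℝ} (hρ : ρ ∈ Set.Ioo (0 : ℝ) 1) (c : ℝ) (X : ℤ) :
    backHeat ρ (fun z => c * (1 - ρ) ^ (X - z - 1)) = 0 := by
  ext z
  have ha : 1 - ρ ≠ 0 := by linarith [hρ.2]
  have : X - (z - 1) - 1 = (X - z - 1) + 1 := by ring
  simp only [backHeat, LinearMap.coe_mk, AddHom.coe_mk, this, zpow_add_one₀ ha, Pi.zero_apply]
  ring

theorem SolvesIBVP.backHeat_pow {ρ : ℝ} {n k : ℕ} {X₀ : ℕ → ℤ} {h : ℕ → ℤ → ℝ}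
    (hh : SolvesIBVP ρ n k X₀ h) {l : ℕ} (hl : l ≤ k) : (backHeat ρ ^ l) (h 0) = h l := by
  induction l with
  | zero => simp
  | succ l ih =>
    rw [pow_succ', Module.End.mul_apply, ih (by omega)]
    ext z
    exact hh.1 l (by omega) z

theorem SolvesIBVP.backHeat_pow_of_lt {ρ : ℝ} (hρ : ρ ∈ Set.Ioo (0 : ℝ) 1) {n k : ℕ}
    {X₀ : ℕ → ℤ} {h : ℕ → ℤ → ℝ} (hh : SolvesIBVP ρ n k X₀ h) {l : ℕ} (hl : k < l) :
    (backHeat ρ ^ l) (h 0) = 0 := by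
  obtain ⟨j, rfl⟩ : ∃ j, l = j + 1 + k := ⟨l - k - 1, by omega⟩
  rw [pow_add, Module.End.mul_apply, hh.backHeat_pow le_rfl, pow_succ, Module.End.mul_apply,
    funext hh.2.1, backHeat_geometric hρ, map_zero]

theorem SolvesIBVP.rightExpBounded {ρ : ℝ} (hρ : ρ ∈ Set.Ioo (0 : ℝ) 1) {n k : ℕ}
    {X₀ : ℕ → ℤ} {h : ℕ → ℤ → ℝ} (hh : SolvesIBVP ρ n k X₀ h) :
    RightExpBounded (2 / (1 - ρ)) (h 0) := by
  refine Nat.decreasingInduction (motive := fun l _ => RightExpBounded (2 / (1 - ρ)) (h l))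
    (fun l hl ih => ?_) ?_ (Nat.zero_le k)
  · refine RightExpBounded.of_backHeat hρ ?_
    convert ih using 1
    exact funext (hh.1 l hl)
  · rw [funext hh.2.1]
    exact rightExpBounded_geometric hρ ρ _

theorem stmt8 (ρ : ℝ) (hρ : ρ ∈ Set.Ioo (0 : ℝ) 1) (t : ℝ) (ht : 0 < t)
    (n : ℕ) (hn : 1 ≤ n)
    (X₀ : ℕ → ℤ) (hX : ∀ i j : ℕ, 1 ≤ i → i < j → j ≤ n → X₀ j < X₀ i)
    (h : ℕ → ℕ → ℤ → ℝ) (hh : ∀ k, k ≤ n - 1 → SolvesIBVP ρ n k X₀ (h k)) :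
    (∀ k, k ≤ n - 1 → ∀ z : ℤ,
      Summable (fun y : ℤ => |((1 - ρ) / ρ) * h k 0 y * Rinv ρ t y z|)) ∧
    (∀ k l, k ≤ n - 1 → l ≤ n - 1 →
      Summable (fun x : ℤ => |Psi ρ t n l X₀ x * Phi ρ t (h k 0) x|) ∧
      (∑' x : ℤ, Psi ρ t n l X₀ x * Phi ρ t (h k 0) x) = (if k = l then 1 else 0)) := by
  refine ⟨fun k hk z => ?_, fun k l hk hl => ?_⟩
  · have hs := (summable_mul_Rinv ρ t ((hh k hk).rightExpBounded hρ) z).mul_left ((1 - ρ) / ρ)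
    simpa only [mul_assoc] using hs.abs
  · have hs := hasSum_Psi_mul_Phi ρ t n l X₀ ((hh k hk).rightExpBounded hρ)
    refine ⟨hs.summable.abs, hs.tsum_eq.trans ?_⟩
    have ha : 1 - ρ ≠ 0 := by linarith [hρ.2]
    have hρ0 : ρ ≠ 0 := hρ.1.ne'
    rcases lt_trichotomy l k with hlk | rfl | hkl
    · rw [(hh k hk).backHeat_pow hlk.le, (hh k hk).2.2 l hlk, if_neg hlk.ne', mul_zero]
    · rw [(hh l hk).backHeat_pow le_rfl, (hh l hk).2.1, if_pos rfl, sub_self, zero_sub,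
        zpow_neg_one]
      field_simp
    · rw [(hh k hk).backHeat_pow_of_lt hρ hkl, if_neg hkl.ne, Pi.zero_apply, mul_zero]
end

section
/- Fix ρ ∈ (0,1), integers N₁, N₂ ≥ 1, set n = N₁ + N₂, let X₀ : {1,…,n} → ℤ be strictly decreasing, and let 0 ≤ k < N₁. Let h^{(n)} solve the backwards-heat IBVP for (ρ, n, k+N₂, X₀); let h^{(N₁)} solve the backwards-heat IBVP for (ρ, N₁, k, X₀ restricted to {1,…,N₁}); let X₀''(i) := X₀(N₁+i) for 1 ≤ i ≤ N₂, for each 0 ≤ j < N₂ let h''_j solve the backwards-heat IBVP for (ρ, N₂, j, X₀''), and set G_{0,N₂}(z₃,z) := Σ_{j=0}^{N₂−1} ((1−ρ)/ρ) Q_ρ^{N₂−j}(z₃, X₀''(N₂−j)) h''_j(0, z). Then for every z ∈ ℤ: h^{(n)}(0, z) = Σ_{z₃∈ℤ} (Q_ρ^{N₂}(z₃, z) − G_{0,N₂}(z₃, z)) · h^{(N₁)}(0, z₃), where the sum over z₃ has only finitely many nonzero terms. -/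
/-- The geometric kernel `Q_ρ(x,y) = ρ(1−ρ)^{x−y−1}` for `x > y`, `0` otherwise. -/
noncomputable def Qker (ρ : ℝ) (x y : ℤ) : ℝ :=
  if y < x then ρ * (1 - ρ) ^ (x - y - 1) else 0

/-- The `m`-fold convolution power of `Q_ρ`. -/
noncomputable def Qpow (ρ : ℝ) : ℕ → ℤ → ℤ → ℝ
  | 0 => fun x y => if x = y then 1 else 0
  | 1 => Qker ρ
  | n + 2 => fun x y => ∑' z : ℤ, Qker ρ x z * Qpow ρ (n + 1) z y

/-- `G_{0,N₂}(z₃,z) := Σ_{j=0}^{N₂−1} ((1−ρ)/ρ) Q_ρ^{N₂−j}(z₃, X₀''(N₂−j)) h''_j(0, z)`. -/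
noncomputable def Gop (ρ : ℝ) (N₂ : ℕ) (X₀'' : ℕ → ℤ) (h'' : ℕ → ℕ → ℤ → ℝ) (z₃ z : ℤ) : ℝ :=
  ∑ j ∈ Finset.range N₂, ((1 - ρ) / ρ) * Qpow ρ (N₂ - j) z₃ (X₀'' (N₂ - j)) * h'' j 0 z

theorem Qker_eq_zero (ρ : ℝ) {x y : ℤ} (h : x ≤ y) : Qker ρ x y = 0 :=
  if_neg (not_lt.mpr h)

theorem Qpow_succ_eq_zero (ρ : ℝ) (m : ℕ) {x y : ℤ} (h : x ≤ y) : Qpow ρ (m + 1) x y = 0 := by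
  induction m generalizing x with
  | zero => exact Qker_eq_zero ρ h
  | succ m ih =>
    change ∑' z : ℤ, Qker ρ x z * Qpow ρ (m + 1) z y = 0
    refine (tsum_congr fun z => ?_).trans tsum_zero
    rcases le_or_gt x z with hz | hz
    · rw [Qker_eq_zero ρ hz, zero_mul]
    · rw [ih (hz.le.trans h), mul_zero]

theorem summable_Qker_mul_Qpow (ρ : ℝ) (m : ℕ) (x y : ℤ) :
    Summable fun z : ℤ => Qker ρ x z * Qpow ρ (m + 1) z y := by
  refine summable_of_ne_finset_zero (s := Finset.Ioo y x) fun z hz => ?_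
  rcases le_or_gt x z with hxz | hxz
  · rw [Qker_eq_zero ρ hxz, zero_mul]
  · have hzy : z ≤ y := by
      by_contra! h
      exact hz (Finset.mem_Ioo.mpr ⟨h, hxz⟩)
    rw [Qpow_succ_eq_zero ρ m hzy, mul_zero]

/-- The backwards-heat operator in the second variable inverts one power of `Q_ρ`. -/
theorem backward_heat_Qpow_succ {ρ : ℝ} (hρ : ρ ∈ Set.Ioo (0 : ℝ) 1) (m : ℕ) (x y : ℤ) :
    (1 / ρ) * Qpow ρ (m + 1) x (y - 1) - ((1 - ρ) / ρ) * Qpow ρ (m + 1) x y = Qpow ρ m x y := by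
  have h0 : ρ ≠ 0 := hρ.1.ne'
  have h1 : 1 - ρ ≠ 0 := (sub_pos.mpr hρ.2).ne'
  induction m generalizing x with
  | zero =>
    change (1 / ρ) * Qker ρ x (y - 1) - ((1 - ρ) / ρ) * Qker ρ x y = if x = y then 1 else 0
    unfold Qker
    rcases lt_trichotomy x y with h | h | h
    · rw [if_neg (by omega), if_neg (by omega), if_neg (by omega)]
      ring
    · subst h
      rw [if_pos (by omega), if_neg (by omega), if_pos rfl]
      simp [h0]
    · rw [if_pos (by omega), if_pos h, if_neg (by omega),
        show x - (y - 1) - 1 = (x - y - 1) + 1 by ring, zpow_add_one₀ h1]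
      field_simp
      ring
  | succ m ih =>
    change (1 / ρ) * ∑' z : ℤ, Qker ρ x z * Qpow ρ (m + 1) z (y - 1)
        - ((1 - ρ) / ρ) * ∑' z : ℤ, Qker ρ x z * Qpow ρ (m + 1) z y = _
    rw [← tsum_mul_left, ← tsum_mul_left,
      ← ((summable_Qker_mul_Qpow ρ m x (y - 1)).mul_left _).tsum_sub
        ((summable_Qker_mul_Qpow ρ m x y).mul_left _)]
    have key : ∀ z : ℤ, 1 / ρ * (Qker ρ x z * Qpow ρ (m + 1) z (y - 1))
        - (1 - ρ) / ρ * (Qker ρ x z * Qpow ρ (m + 1) z y) = Qker ρ x z * Qpow ρ m z y := by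
      intro z
      rw [← ih z]
      ring
    rw [tsum_congr key]
    cases m with
    | zero =>
      change ∑' z : ℤ, Qker ρ x z * (if z = y then 1 else 0) = Qker ρ x y
      rw [tsum_eq_single y fun z hz => by rw [if_neg hz, mul_zero], if_pos rfl, mul_one]
    | succ m => rfl

/-- If the source term of the backwards-heat equation stays in a submodule, so does the solution
vanishing at a boundary point. -/
theorem backward_heat_induction {V : Type*} [AddCommGroup V] [Module ℝ V] {ρ : ℝ}
    (hρ : ρ ∈ Set.Ioo (0 : ℝ) 1) (S : Submodule ℝ V) {F G : ℤ → V} {b : ℤ} (hb : F b = 0)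
    (hFG : ∀ z, (1 / ρ) • F (z - 1) - ((1 - ρ) / ρ) • F z = G z) (hG : ∀ z, G z ∈ S) (z : ℤ) :
    F z ∈ S := by
  have h0 : ρ ≠ 0 := hρ.1.ne'
  have h1 : 1 - ρ ≠ 0 := (sub_pos.mpr hρ.2).ne'
  have hprev : ∀ z, F (z - 1) = (1 - ρ) • F z + ρ • G z := by
    intro z
    rw [← hFG z, smul_sub, smul_smul, smul_smul, mul_one_div_cancel h0, mul_div_cancel₀ _ h0,
      one_smul]
    abel
  induction z using Int.inductionOn' with
  | b => exact b
  | zero => rw [hb]; exact S.zero_mem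
  | succ z _ ih =>
    have h := hprev (z + 1)
    rw [add_sub_cancel_right] at h
    have hF : (1 - ρ) • F (z + 1) ∈ S := by
      rw [← add_sub_cancel_right ((1 - ρ) • F (z + 1)) (ρ • G (z + 1)), ← h]
      exact S.sub_mem ih (S.smul_mem _ (hG _))
    exact (S.smul_mem_iff h1).mp hF
  | pred z _ ih =>
    rw [hprev z]
    exact S.add_mem (S.smul_mem _ ih) (S.smul_mem _ (hG _))

/-- Zero-boundary solutions of the backwards-heat equation are determined by the source term. -/
theorem backward_heat_unique {ρ : ℝ} (hρ : ρ ∈ Set.Ioo (0 : ℝ) 1) {f f' g : ℤ → ℝ} {b : ℤ}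
    (hb : f b = 0) (hb' : f' b = 0)
    (hf : ∀ z, (1 / ρ) * f (z - 1) - ((1 - ρ) / ρ) * f z = g z)
    (hf' : ∀ z, (1 / ρ) * f' (z - 1) - ((1 - ρ) / ρ) * f' z = g z) (z : ℤ) : f z = f' z := by
  have h := backward_heat_induction hρ (⊥ : Submodule ℝ ℝ) (F := fun z => f z - f' z)
    (G := fun _ => 0) (b := b) (by simp [hb, hb'])
    (fun z => by simp only [smul_eq_mul]; linear_combination hf z - hf' z)
    (fun _ => Submodule.zero_mem _) z
  exact sub_eq_zero.mp ((Submodule.mem_bot ℝ).mp h)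

/-- A solution of the IBVP started at level `k + m` restricts, from level `m` on, to the solution
for the first `n` particles. -/
theorem SolvesIBVP.eq_shift {ρ : ℝ} (hρ : ρ ∈ Set.Ioo (0 : ℝ) 1) {n m k : ℕ} {X : ℕ → ℤ}
    {h h' : ℕ → ℤ → ℝ} (hh : SolvesIBVP ρ (n + m) (k + m) X h) (hh' : SolvesIBVP ρ n k X h')
    {l : ℕ} (hl : l ≤ k) : h (l + m) = h' l := by
  induction hl using Nat.decreasingInduction with
  | self =>
    funext z
    rw [hh.2.1, hh'.2.1, Nat.add_sub_add_right]
  | of_succ l hl ih =>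
    funext z
    refine backward_heat_unique hρ (b := X (n - l)) (g := h' (l + 1)) ?_ (hh'.2.2 l hl) ?_
      (hh'.1 l hl) z
    · simpa only [Nat.add_sub_add_right] using hh.2.2 (l + m) (by omega)
    · intro z
      rw [hh.1 (l + m) (by omega), ← ih]
      congr 1
      omega

/-- The pairs `(φ, v)` for which `φ` has finite support and pairs with `f` to give `v`. -/
noncomputable def finitePairing (f : ℤ → ℝ) : Submodule ℝ ((ℤ → ℝ) × ℝ) :=
  LinearMap.range (Finsupp.lcoeFun.prod (Finsupp.linearCombination ℝ f) :
    (ℤ →₀ ℝ) →ₗ[ℝ] (ℤ → ℝ) × ℝ)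

theorem finite_and_eq_tsum_of_mem_finitePairing {f φ : ℤ → ℝ} {v : ℝ}
    (h : (φ, v) ∈ finitePairing f) :
    {x | φ x * f x ≠ 0}.Finite ∧ v = ∑' x, φ x * f x := by
  obtain ⟨c, hc⟩ := h
  obtain ⟨rfl, rfl⟩ := Prod.mk.inj hc
  refine ⟨c.support.finite_toSet.subset fun x hx => ?_, ?_⟩
  · exact Finsupp.mem_support_iff.mpr (left_ne_zero_of_mul hx)
  · rw [tsum_eq_sum (s := c.support) fun x hx => by
      simp [Finsupp.notMem_support_iff.mp hx]]
    simp [Finsupp.linearCombination_apply, Finsupp.sum]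

/-- The kernel solving `m - l` steps of the backwards-heat equation with zero boundary values;
at `l = 0` it is `Q_ρ^m - G_{0,m}`. -/
noncomputable def boundaryKernel (ρ : ℝ) (m : ℕ) (X : ℕ → ℤ) (h : ℕ → ℕ → ℤ → ℝ) (l : ℕ)
    (z x : ℤ) : ℝ :=
  Qpow ρ (m - l) x z
    - ∑ j ∈ Finset.Ico l m, ((1 - ρ) / ρ) * Qpow ρ (m - j) x (X (m - j)) * h j l z

section boundaryKernel

variable {ρ : ℝ} {m : ℕ} {X : ℕ → ℤ} {h : ℕ → ℕ → ℤ → ℝ}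

theorem boundaryKernel_boundary (hρ : ρ ∈ Set.Ioo (0 : ℝ) 1)
    (hh : ∀ j, j < m → SolvesIBVP ρ m j X (h j)) {l : ℕ} (hl : l < m) (x : ℤ) :
    boundaryKernel ρ m X h l (X (m - l)) x = 0 := by
  have h0 : ρ ≠ 0 := hρ.1.ne'
  have h1 : 1 - ρ ≠ 0 := (sub_pos.mpr hρ.2).ne'
  unfold boundaryKernel
  rw [Finset.sum_eq_sum_Ico_succ_bot hl, Finset.sum_eq_zero, (hh l hl).2.1, sub_self, zero_sub,
    zpow_neg_one]
  · field_simp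
    ring
  · intro j hj
    rw [Finset.mem_Ico] at hj
    rw [(hh j hj.2).2.2 l (by omega), mul_zero]

theorem backward_heat_boundaryKernel (hρ : ρ ∈ Set.Ioo (0 : ℝ) 1)
    (hh : ∀ j, j < m → SolvesIBVP ρ m j X (h j)) {l : ℕ} (hl : l < m) (z x : ℤ) :
    (1 / ρ) * boundaryKernel ρ m X h l (z - 1) x - ((1 - ρ) / ρ) * boundaryKernel ρ m X h l z x
      = boundaryKernel ρ m X h (l + 1) z x := by
  have h1 : 1 - ρ ≠ 0 := (sub_pos.mpr hρ.2).ne'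
  unfold boundaryKernel
  have hQ := backward_heat_Qpow_succ hρ (m - (l + 1)) x z
  rw [show m - (l + 1) + 1 = m - l by omega] at hQ
  have hbot : h l l (z - 1) = (1 - ρ) * h l l z := by
    rw [(hh l hl).2.1, (hh l hl).2.1,
      show X (m - l) - (z - 1) - 1 = (X (m - l) - z - 1) + 1 by ring, zpow_add_one₀ h1]
    ring
  have hsum : ∑ j ∈ Finset.Ico (l + 1) m,
        ((1 - ρ) / ρ) * Qpow ρ (m - j) x (X (m - j)) * h j (l + 1) z
      = (1 / ρ) * ∑ j ∈ Finset.Ico (l + 1) m,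
          ((1 - ρ) / ρ) * Qpow ρ (m - j) x (X (m - j)) * h j l (z - 1)
        - ((1 - ρ) / ρ) * ∑ j ∈ Finset.Ico (l + 1) m,
          ((1 - ρ) / ρ) * Qpow ρ (m - j) x (X (m - j)) * h j l z := by
    rw [Finset.mul_sum, Finset.mul_sum, ← Finset.sum_sub_distrib]
    refine Finset.sum_congr rfl fun j hj => ?_
    rw [Finset.mem_Ico] at hj
    rw [← (hh j hj.2).1 l (by omega)]
    ring
  rw [Finset.sum_eq_sum_Ico_succ_bot hl, Finset.sum_eq_sum_Ico_succ_bot hl, hsum, ← hQ, hbot]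
  ring

theorem boundaryKernel_mem_finitePairing (hρ : ρ ∈ Set.Ioo (0 : ℝ) 1)
    (hh : ∀ j, j < m → SolvesIBVP ρ m j X (h j)) {u : ℕ → ℤ → ℝ}
    (hu : ∀ l, l < m → ∀ z, (1 / ρ) * u l (z - 1) - ((1 - ρ) / ρ) * u l z = u (l + 1) z)
    (hu0 : ∀ l, l < m → u l (X (m - l)) = 0) {l : ℕ} (hl : l ≤ m) (z : ℤ) :
    (boundaryKernel ρ m X h l z, u l z) ∈ finitePairing (u m) := by
  induction hl using Nat.decreasingInduction generalizing z with
  | self =>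
    refine ⟨Finsupp.single z 1, Prod.ext (funext fun x => ?_) ?_⟩
    · simp [boundaryKernel, Qpow, Finsupp.single_apply, eq_comm]
    · simp
  | of_succ l hl ih =>
    refine backward_heat_induction hρ _
      (F := fun z => (boundaryKernel ρ m X h l z, u l z)) (b := X (m - l)) ?_ (fun z => ?_) ih z
    · exact Prod.ext (funext fun x => boundaryKernel_boundary hρ hh hl x) (hu0 l hl)
    · exact Prod.ext (funext fun x => backward_heat_boundaryKernel hρ hh hl z x) (hu l hl z)

end boundaryKernel

theorem stmt12 (ρ : ℝ) (hρ : ρ ∈ Set.Ioo (0 : ℝ) 1) (N₁ N₂ : ℕ) (hN₁ : 1 ≤ N₁)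
    (hN₂ : 1 ≤ N₂) (k : ℕ) (hk : k < N₁)
    (X₀ : ℕ → ℤ) (hX : ∀ i j : ℕ, 1 ≤ i → i < j → j ≤ N₁ + N₂ → X₀ j < X₀ i)
    (hN : ℕ → ℤ → ℝ) (hhN : SolvesIBVP ρ (N₁ + N₂) (k + N₂) X₀ hN)
    (hN1 : ℕ → ℤ → ℝ) (hhN1 : SolvesIBVP ρ N₁ k X₀ hN1)
    (h'' : ℕ → ℕ → ℤ → ℝ)
    (hh'' : ∀ j, j < N₂ → SolvesIBVP ρ N₂ j (fun i => X₀ (N₁ + i)) (h'' j)) :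
    ∀ z : ℤ,
      {z₃ : ℤ | (Qpow ρ N₂ z₃ z - Gop ρ N₂ (fun i => X₀ (N₁ + i)) h'' z₃ z) * hN1 0 z₃
          ≠ 0}.Finite ∧
      hN 0 z
        = ∑' z₃ : ℤ,
            (Qpow ρ N₂ z₃ z - Gop ρ N₂ (fun i => X₀ (N₁ + i)) h'' z₃ z) * hN1 0 z₃ := by
  intro z
  have hshift : hN N₂ = hN1 0 := by
    simpa only [Nat.zero_add] using hhN.eq_shift hρ hhN1 (Nat.zero_le k)
  have hmem := boundaryKernel_mem_finitePairing (X := fun i => X₀ (N₁ + i)) hρ hh'' (u := hN)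
    (fun l hl => hhN.1 l (by omega))
    (fun l hl => by
      have h := hhN.2.2 l (by omega)
      rwa [Nat.add_sub_assoc hl.le] at h)
    (Nat.zero_le N₂) z
  rw [hshift] at hmem
  have h := finite_and_eq_tsum_of_mem_finitePairing hmem
  simpa only [boundaryKernel, Gop, Finset.range_eq_Ico, Nat.sub_zero] using h
end
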